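/- Let K be a finite field, V a finite-dimensional K-vector space with dim_K V ≥ 2, and G an infinite finitely generated group. Then the full vector shift V^G admits infinitely many compatible Lie brackets: the set of maps β : V^G × V^G → V^G that are continuous, G-equivariant, K-bilinear, alternating, and satisfy the Jacobi identity (with respect to the pointwise K-vector space structure of V^G) is infinite. -/

import Mathlib

/-- The left shift action on the full shift `V^G`: `(g • x) h = x (g⁻¹ h)`. -/
def shiftMap {G V : Type} [Group G] (g : G) (x : G → V) : G → V :=
  fun h => x (g⁻¹ * h)

/-- A compatible Lie bracket on the full vector shift `V^G`: a continuous
`G`-equivariant `K`-bilinear alternating map satisfying the Jacobi identity,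
with respect to the pointwise `K`-vector space structure of `V^G`. -/
def IsCompatibleBracket (K : Type) [Field K] (G : Type) [Group G]
    (V : Type) [AddCommGroup V] [Module K V] [TopologicalSpace V]
    (β : (G → V) → (G → V) → (G → V)) : Prop :=
  Continuous (fun p : (G → V) × (G → V) => β p.1 p.2) ∧
  (∀ (g : G) (x y : G → V), β (shiftMap g x) (shiftMap g y) = shiftMap g (β x y)) ∧
  (∀ x y z : G → V, β (x + y) z = β x z + β y z) ∧
  (∀ (c : K) (x y : G → V), β (c • x) y = c • β x y) ∧
  (∀ x y z : G → V, β z (x + y) = β z x + β z y) ∧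
  (∀ (c : K) (x y : G → V), β x (c • y) = c • β x y) ∧
  (∀ x : G → V, β x x = 0) ∧
  (∀ x y z : G → V, β (β x y) z + β (β y z) x + β (β z x) y = 0)

/-- The bracket `β_s(x,y)(h) = (f (x (h s)) g (y h) - f (y (h s)) g (x h)) v`. -/
def famBracket {K G V : Type} [Field K] [Group G] [AddCommGroup V] [Module K V]
    (f g : V →ₗ[K] K) (v : V) (s : G) (x y : G → V) : G → V :=
  fun h => (f (x (h * s)) * g (y h) - f (y (h * s)) * g (x h)) • v

theorem famBracket_compatible {K G V : Type} [Field K] [Group G] [AddCommGroup V] [Module K V]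
    [TopologicalSpace V] [DiscreteTopology V]
    (f g : V →ₗ[K] K) (v : V) (hf : f v = 0) (hg : g v = 1) (s : G) :
    IsCompatibleBracket K G V (famBracket f g v s) := by
  refine ⟨?_, ?_, ?_, ?_, ?_, ?_, ?_, ?_⟩
  · refine continuous_pi fun h => ?_
    let φ : (V × V) × (V × V) → V := fun q =>
      (f q.1.1 * g q.2.2 - f q.1.2 * g q.2.1) • v
    have hφ : Continuous φ := continuous_of_discreteTopology
    have hψ : Continuous (fun p : (G → V) × (G → V) =>
        (((p.1 (h * s), p.2 (h * s)), (p.1 h, p.2 h)) : (V × V) × (V × V))) := by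
      fun_prop
    exact hφ.comp hψ
  · intro a x y
    funext h
    simp [famBracket, shiftMap, mul_assoc]
  · intro x y z
    funext h
    simp only [famBracket, Pi.add_apply, map_add, ← add_smul]
    congr 1; ring
  · intro c x y
    funext h
    simp only [famBracket, Pi.smul_apply, map_smul, smul_smul, smul_eq_mul]
    congr 1; ring
  · intro x y z
    funext h
    simp only [famBracket, Pi.add_apply, map_add, ← add_smul]
    congr 1; ring
  · intro c x y
    funext h
    simp only [famBracket, Pi.smul_apply, map_smul, smul_smul, smul_eq_mul]
    congr 1; ring
  · intro x
    funext h
    simp [famBracket]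
  · intro x y z
    funext h
    simp only [famBracket, Pi.add_apply, Pi.zero_apply, map_smul, smul_eq_mul, hf, hg, ← add_smul]
    convert zero_smul K v using 2
    ring

/-- If `K` is a finite field, `V` a `K`-vector space of dimension at
least `2`, and `G` an infinite finitely generated group, then the full vector shift
`V^G` admits infinitely many compatible Lie brackets. -/
theorem infinitely_many_compatible_brackets
    (K : Type) [Field K] [Fintype K]
    (V : Type) [AddCommGroup V] [Module K V] [FiniteDimensional K V]
    [TopologicalSpace V] [DiscreteTopology V]
    (hdim : 2 ≤ Module.finrank K V)
    (G : Type) [Group G] [Infinite G] (hFG : Group.FG G) :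
    {β : (G → V) → (G → V) → (G → V) | IsCompatibleBracket K G V β}.Infinite := by
  classical
  let b := Module.finBasis K V
  let i : Fin (Module.finrank K V) := ⟨0, by omega⟩
  let j : Fin (Module.finrank K V) := ⟨1, by omega⟩
  have hij : i ≠ j := by simp [i, j]
  have h1 : b.coord i (b j) = 0 := by simp [Finsupp.single_apply, hij.symm]
  have h2 : b.coord j (b j) = 1 := by simp
  have h3 : b.coord i (b i) = 1 := by simp
  refine Set.infinite_of_injective_forall_mem
    (f := fun s : G => famBracket (b.coord i) (b.coord j) (b j) s) ?_
    (fun s => famBracket_compatible _ _ _ h1 h2 s)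
  intro s t hst
  by_contra hne
  have h := congrFun (congrFun (congrFun hst (Pi.single s (b i))) (fun _ => b j)) 1
  simp only [famBracket, one_mul, h1, h2, zero_mul, sub_zero, mul_one, Pi.single_eq_same, h3,
    Pi.single_eq_of_ne (Ne.symm hne), map_zero, zero_smul, one_smul] at h
  exact b.ne_zero j h
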